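/- arXiv:1710.06045 — 2 statements merged into one kernel-verified Lean document; each statement's English description precedes it below -/
import Mathlib

section
/- Let p ∈ ℂ[z] be a polynomial of degree at least 2 without multiple roots, and let f ∈ O(D_p) have Laurent expansion f = Σ_{i=l}^{k} a_i(z)x^i with a_l ≠ 0, a_k ≠ 0 and 1 ≤ l ≤ k. Then ν_y(f) = Σ_{i=l}^{k} (i·p′(z)a_i(z) + p(z)a_i′(z))x^{i−1}, and the coefficients of x^{l−1} and x^{k−1} in this expansion are nonzero; in particular ν_y(f) has minimal x-degree l−1 and maximal x-degree k−1. -/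
open Polynomial

set_option synthInstance.maxHeartbeats 400000
set_option maxHeartbeats 800000

noncomputable section

/-- The polynomial ring `ℂ[x,y,z]` (variables indexed by `Fin 3`). -/
abbrev P3 : Type := MvPolynomial (Fin 3) ℂ

/-- The variable `x`. -/
def xP : P3 := MvPolynomial.X 0
/-- The variable `y`. -/
def yP : P3 := MvPolynomial.X 1
/-- The variable `z`. -/
def zP : P3 := MvPolynomial.X 2

/-- The ideal `(xy - p(z)) ⊆ ℂ[x,y,z]`. -/
def relIdeal (p : ℂ[X]) : Ideal P3 := Ideal.span {xP * yP - Polynomial.aeval zP p}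

/-- The coordinate ring `O(D_p) = ℂ[x,y,z]/(xy - p(z))` of the Danielewski surface `D_p`. -/
abbrev ODan (p : ℂ[X]) : Type := P3 ⧸ relIdeal p

/-- The Laurent polynomial ring `ℂ[z][x,x⁻¹]`. -/
abbrev LZ : Type := LaurentPolynomial (Polynomial ℂ)

/-- The lift `p'(z)∂/∂x + y∂/∂z` of `ν_y` to a derivation of `ℂ[x,y,z]`. -/
def nuyLift (p : ℂ[X]) : Derivation ℂ P3 P3 :=
  MvPolynomial.mkDerivation ℂ ![Polynomial.aeval zP (Polynomial.derivative p), 0, yP]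

/-- The derivation `C(q) T^i ↦ C(i p' q + p q') T^(i-1)` of the Laurent ring, additively. -/
def EE (p : ℂ[X]) : LZ →+ LZ :=
  (Finsupp.liftAddHom (fun i : ℤ =>
    ((AddMonoidAlgebra.singleAddHom (R := ℂ[X]) (i - 1)).comp
      ((AddMonoidHom.mulLeft ((i : ℂ[X]) * derivative p)) +
        (AddMonoidHom.mulLeft p).comp
          (derivative : ℂ[X] →ₗ[ℂ] ℂ[X]).toAddMonoidHom)))).comp
    (AddMonoidAlgebra.coeffAddEquiv (R := ℂ[X]) (M := ℤ)).toAddMonoidHom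

theorem EE_CT (p q : ℂ[X]) (i : ℤ) :
    EE p (LaurentPolynomial.C q * LaurentPolynomial.T i) =
      LaurentPolynomial.C ((i : ℂ[X]) * derivative p * q + p * derivative q) *
        LaurentPolynomial.T (i - 1) := by
  rw [← LaurentPolynomial.single_eq_C_mul_T, ← LaurentPolynomial.single_eq_C_mul_T]
  change Finsupp.liftAddHom _ (Finsupp.single i q) = _
  rw [Finsupp.liftAddHom_apply_single]
  rfl

theorem EE_leibniz (p : ℂ[X]) (u v : LZ) : EE p (u * v) = EE p u * v + u * EE p v := by
  induction u using LaurentPolynomial.induction_on' with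
  | add u₁ u₂ h₁ h₂ => simp only [add_mul, map_add, h₁, h₂]; ring
  | C_mul_T i q =>
    induction v using LaurentPolynomial.induction_on' with
    | add u₁ u₂ h₁ h₂ => simp only [mul_add, map_add, h₁, h₂]; ring
    | C_mul_T j r =>
      have h : (LaurentPolynomial.C q * LaurentPolynomial.T i : LZ) *
          (LaurentPolynomial.C r * LaurentPolynomial.T j) =
          LaurentPolynomial.C (q * r) * LaurentPolynomial.T (i + j) := by
        rw [LaurentPolynomial.T_add, map_mul]; ring
      rw [h, EE_CT, EE_CT, EE_CT]
      simp only [derivative_mul, map_add, map_mul, Int.cast_add, LaurentPolynomial.T_sub,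
        LaurentPolynomial.T_add]
      ring

theorem coeff_ne (p q : ℂ[X]) (hp2 : 2 ≤ p.natDegree) (hq : q ≠ 0) (l : ℤ) (hl : 1 ≤ l) :
    (l : ℂ[X]) * derivative p * q + p * derivative q ≠ 0 := by
  intro h
  obtain ⟨n, rfl⟩ : ∃ n : ℕ, l = ((n + 1 : ℕ) : ℤ) := ⟨(l - 1).toNat, by omega⟩
  have hp : p ≠ 0 := by rintro rfl; simp at hp2
  have hd : derivative (p ^ (n + 1) * q) = 0 := by
    have : derivative (p ^ (n + 1) * q) = p ^ n *
        ((((n + 1 : ℕ) : ℤ) : ℂ[X]) * derivative p * q + p * derivative q) := by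
      rw [derivative_mul, derivative_pow_succ]
      push_cast
      simp
      ring
    rw [this, h, mul_zero]
  have h0 := derivative_eq_zero.1 hd
  rw [natDegree_mul (pow_ne_zero _ hp) hq, natDegree_pow] at h0
  have : (n + 1) * p.natDegree = 0 := by omega
  rcases Nat.mul_eq_zero.1 this with h | h <;> omega

/-- Let `p` be squarefree of degree at least `2`.  Embed `O(D_p)` into `ℂ[z][x,x⁻¹]` by
`x ↦ x`, `z ↦ z`, `y ↦ x⁻¹p(z)`, and let `ν_y` be the derivation of `O(D_p)` induced by
`p'(z)∂/∂x + y∂/∂z`.  If `f ∈ O(D_p)` has Laurent expansion `f = Σ_{i=l}^{k} aᵢ(z)xⁱ`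
with `a_l ≠ 0`, `a_k ≠ 0` and `1 ≤ l ≤ k`, then
`ν_y(f) = Σ_{i=l}^{k} (i·p'(z)aᵢ(z) + p(z)aᵢ'(z))x^{i-1}` and the coefficients of
`x^{l-1}` and `x^{k-1}` are nonzero; in particular `ν_y(f)` has minimal `x`-degree
`l-1` and maximal `x`-degree `k-1`. -/
theorem nuy_bidegree (p : ℂ[X])
    (hsp : Squarefree p) (hp2 : 2 ≤ p.natDegree)
    (ψ : ODan p →ₐ[ℂ] LZ)
    (hψx : ψ (Ideal.Quotient.mk (relIdeal p) xP) = LaurentPolynomial.T 1)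
    (hψz : ψ (Ideal.Quotient.mk (relIdeal p) zP) = LaurentPolynomial.C Polynomial.X)
    (hψy : ψ (Ideal.Quotient.mk (relIdeal p) yP) =
      LaurentPolynomial.C p * LaurentPolynomial.T (-1))
    (νy : Derivation ℂ (ODan p) (ODan p))
    (hνy : ∀ f : P3, νy (Ideal.Quotient.mk (relIdeal p) f) =
      Ideal.Quotient.mk (relIdeal p) (nuyLift p f))
    (f : ODan p) (l k : ℤ) (hl : 1 ≤ l) (hlk : l ≤ k)
    (a : ℤ → Polynomial ℂ) (hal : a l ≠ 0) (hak : a k ≠ 0)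
    (hexp : ψ f = ∑ i ∈ Finset.Icc l k, LaurentPolynomial.C (a i) * LaurentPolynomial.T i) :
    ψ (νy f) = ∑ i ∈ Finset.Icc l k,
        LaurentPolynomial.C ((i : Polynomial ℂ) * Polynomial.derivative p * a i
          + p * Polynomial.derivative (a i)) * LaurentPolynomial.T (i - 1) ∧
      ((l : Polynomial ℂ) * Polynomial.derivative p * a l + p * Polynomial.derivative (a l)) ≠ 0 ∧
      ((k : Polynomial ℂ) * Polynomial.derivative p * a k + p * Polynomial.derivative (a k)) ≠ 0 := by
  have hC : ∀ q : ℂ[X], ψ (Ideal.Quotient.mk (relIdeal p) (Polynomial.aeval zP q)) =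
      LaurentPolynomial.C q := by
    intro q
    induction q using Polynomial.induction_on' with
    | add a b ha hb => simp only [map_add, ha, hb]
    | monomial n c =>
      rw [Polynomial.aeval_monomial, map_mul, map_mul, map_pow, map_pow, hψz,
        ← Polynomial.C_mul_X_pow_eq_monomial, map_mul, map_pow]
      congr 1
      exact ψ.commutes c
  have key : ∀ g : P3, ψ (Ideal.Quotient.mk (relIdeal p) (nuyLift p g)) =
      EE p (ψ (Ideal.Quotient.mk (relIdeal p) g)) := by
    intro g
    induction g using MvPolynomial.induction_on with
    | C c =>
      have h1 : nuyLift p (MvPolynomial.C c) = 0 := (nuyLift p).map_algebraMap c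
      have h2 : ψ (Ideal.Quotient.mk (relIdeal p) (MvPolynomial.C c)) =
          LaurentPolynomial.C (Polynomial.C c) * LaurentPolynomial.T 0 := by
        rw [LaurentPolynomial.T_zero, mul_one]
        exact ψ.commutes c
      rw [h1, h2, EE_CT]
      simp
    | add a b ha hb => simp only [map_add, ha, hb]
    | mul_X g i hg =>
      have hX : ψ (Ideal.Quotient.mk (relIdeal p) (nuyLift p (MvPolynomial.X i))) =
          EE p (ψ (Ideal.Quotient.mk (relIdeal p) (MvPolynomial.X i))) := by
        rw [nuyLift, MvPolynomial.mkDerivation_X]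
        fin_cases i
        · change ψ (Ideal.Quotient.mk (relIdeal p) (Polynomial.aeval zP (derivative p))) =
            EE p (ψ (Ideal.Quotient.mk (relIdeal p) xP))
          have h := EE_CT p 1 1
          rw [map_one, one_mul] at h
          rw [hC, hψx, h]
          simp
        · change ψ (Ideal.Quotient.mk (relIdeal p) 0) =
            EE p (ψ (Ideal.Quotient.mk (relIdeal p) yP))
          rw [hψy, EE_CT, map_zero, map_zero]
          have h : ((-1 : ℤ) : ℂ[X]) * derivative p * p + p * derivative p = 0 := by
            push_cast; ring
          rw [h, map_zero, zero_mul]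
        · change ψ (Ideal.Quotient.mk (relIdeal p) yP) =
            EE p (ψ (Ideal.Quotient.mk (relIdeal p) zP))
          have h := EE_CT p Polynomial.X 0
          rw [LaurentPolynomial.T_zero, mul_one] at h
          rw [hψy, hψz, h]
          simp
      rw [Derivation.leibniz, smul_eq_mul, smul_eq_mul, map_add, map_add, map_mul, map_mul,
        map_mul, map_mul, map_mul, map_mul, EE_leibniz, hg, hX]
      ring
  refine ⟨?_, coeff_ne p _ hp2 hal l hl, coeff_ne p _ hp2 hak k (hl.trans hlk)⟩
  obtain ⟨g, rfl⟩ := Ideal.Quotient.mk_surjective f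
  rw [hνy, key, hexp, map_sum]
  exact Finset.sum_congr rfl fun i _ => EE_CT p (a i) i

end
end

section
/- Let p ∈ ℂ[z] be a polynomial of degree at least 2 without multiple roots. Let Ĩ ⊆ V be a nonzero ℂ-linear subspace such that {g, f} ∈ Ĩ for all g ∈ V and f ∈ Ĩ. Then Ĩ contains the class of a nonconstant polynomial h(z) ∈ ℂ[z]. -/
open Polynomial

set_option synthInstance.maxHeartbeats 400000
set_option maxHeartbeats 800000

noncomputable section

open MvPolynomial in
/-- The Poisson-type bracket
`{f,g} = p'(z)(f_y g_x - f_x g_y) + x(f_z g_x - f_x g_z) - y(f_z g_y - f_y g_z)`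
on `ℂ[x,y,z]`. -/
def pb (p : ℂ[X]) (f g : P3) : P3 :=
  Polynomial.aeval zP (Polynomial.derivative p) *
      (pderiv (1 : Fin 3) f * pderiv (0 : Fin 3) g - pderiv (0 : Fin 3) f * pderiv (1 : Fin 3) g)
    + xP * (pderiv (2 : Fin 3) f * pderiv (0 : Fin 3) g -
        pderiv (0 : Fin 3) f * pderiv (2 : Fin 3) g)
    - yP * (pderiv (2 : Fin 3) f * pderiv (1 : Fin 3) g -
        pderiv (1 : Fin 3) f * pderiv (2 : Fin 3) g)

/-- The line of constants `ℂ·1 ⊆ O(D_p)`. -/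
def constSub (p : ℂ[X]) : Submodule ℂ (ODan p) := Submodule.span ℂ {(1 : ODan p)}

/-- The quotient space `O(D_p)/ℂ·1`. -/
abbrev QDan (p : ℂ[X]) : Type := ODan p ⧸ constSub p

/-- The class in `O(D_p)/ℂ·1` of a polynomial `f ∈ ℂ[x,y,z]`. -/
def cls (p : ℂ[X]) (f : P3) : QDan p :=
  Submodule.Quotient.mk (Ideal.Quotient.mk (relIdeal p) f)

/-- The generating set of `S`: the classes of `xⁱzʲ` (`i ≥ 1`), `yⁱzʲ` (`i ≥ 1`) and
`(p(z)r(z))'` for `r ∈ ℂ[z]`. -/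
def Sgen (p : ℂ[X]) : Set (ODan p) :=
  {w | (∃ i j : ℕ, 1 ≤ i ∧ w = Ideal.Quotient.mk (relIdeal p) (xP ^ i * zP ^ j)) ∨
       (∃ i j : ℕ, 1 ≤ i ∧ w = Ideal.Quotient.mk (relIdeal p) (yP ^ i * zP ^ j)) ∨
       (∃ r : ℂ[X], w = Ideal.Quotient.mk (relIdeal p)
          (Polynomial.aeval zP (Polynomial.derivative (p * r))))}

/-- `V`: the image in `O(D_p)/ℂ·1` of the span `S` of the classes of `xⁱzʲ`, `yⁱzʲ`
(`i ≥ 1`) and `(p(z)r(z))'`. -/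
def Vsub (p : ℂ[X]) : Submodule ℂ (QDan p) :=
  (Submodule.span ℂ (Sgen p)).map (constSub p).mkQ

/-- `cls` as a linear map. -/
def clsL (p : ℂ[X]) : P3 →ₗ[ℂ] QDan p :=
  (constSub p).mkQ.comp (Ideal.Quotient.mkₐ ℂ (relIdeal p)).toLinearMap

theorem cls_eq (p : ℂ[X]) (f : P3) : cls p f = clsL p f := rfl

/-- Substituting `z`. -/
abbrev az (h : ℂ[X]) : P3 := Polynomial.aeval zP h

theorem clsL_congr (p : ℂ[X]) (f g c : P3) (h : f - g = c * (xP * yP - az p)) :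
    clsL p f = clsL p g := by
  have : Ideal.Quotient.mk (relIdeal p) f = Ideal.Quotient.mk (relIdeal p) g := by
    rw [Ideal.Quotient.eq, h]
    exact Ideal.mul_mem_left _ _ (Ideal.subset_span rfl)
  change (constSub p).mkQ (Ideal.Quotient.mk (relIdeal p) f) = _
  rw [this]; rfl

theorem clsL_C (p : ℂ[X]) (c : ℂ) : clsL p (az (Polynomial.C c)) = 0 := by
  change (constSub p).mkQ (Ideal.Quotient.mk (relIdeal p) (az (Polynomial.C c))) = 0
  rw [Submodule.mkQ_apply, Submodule.Quotient.mk_eq_zero, constSub,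
    Submodule.mem_span_singleton]
  refine ⟨c, ?_⟩
  rw [az, Polynomial.aeval_C, Algebra.algebraMap_eq_smul_one]
  rfl

theorem pderiv_az (i : Fin 3) (h : ℂ[X]) : MvPolynomial.pderiv i (az h) =
    az (Polynomial.derivative h) * MvPolynomial.pderiv i zP := by
  induction h using Polynomial.induction_on' with
  | add a b ha hb => simp only [az, map_add, add_mul] at *; rw [ha, hb]
  | monomial n a =>
    simp only [az, Polynomial.aeval_monomial, Polynomial.derivative_monomial, Derivation.leibniz,
      Derivation.leibniz_pow, Derivation.map_algebraMap, smul_eq_mul, nsmul_eq_mul, map_mul,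
      map_natCast]
    ring

theorem d0x : MvPolynomial.pderiv (0 : Fin 3) xP = 1 := by simp [xP]
theorem d1x : MvPolynomial.pderiv (1 : Fin 3) xP = 0 := by
  rw [xP, MvPolynomial.pderiv_X_of_ne (by decide)]
theorem d2x : MvPolynomial.pderiv (2 : Fin 3) xP = 0 := by
  rw [xP, MvPolynomial.pderiv_X_of_ne (by decide)]
theorem d0y : MvPolynomial.pderiv (0 : Fin 3) yP = 0 := by
  rw [yP, MvPolynomial.pderiv_X_of_ne (by decide)]
theorem d1y : MvPolynomial.pderiv (1 : Fin 3) yP = 1 := by simp [yP]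
theorem d2y : MvPolynomial.pderiv (2 : Fin 3) yP = 0 := by
  rw [yP, MvPolynomial.pderiv_X_of_ne (by decide)]
theorem d0z : MvPolynomial.pderiv (0 : Fin 3) zP = 0 := by
  rw [zP, MvPolynomial.pderiv_X_of_ne (by decide)]
theorem d1z : MvPolynomial.pderiv (1 : Fin 3) zP = 0 := by
  rw [zP, MvPolynomial.pderiv_X_of_ne (by decide)]
theorem d2z : MvPolynomial.pderiv (2 : Fin 3) zP = 1 := by simp [zP]

/-- `{y, x^{i+1} h}`. -/
theorem br_y (p h : ℂ[X]) (i : ℕ) :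
    clsL p (pb p yP (xP ^ (i + 1) * az h)) =
      clsL p (xP ^ i * az (((i : ℂ[X]) + 1) * derivative p * h + p * derivative h)) := by
  apply clsL_congr p _ _ (xP ^ i * az (derivative h))
  simp only [pb, Derivation.leibniz, Derivation.leibniz_pow, pderiv_az, d0x, d1x, d2x, d0y, d1y,
    d2y, d0z, d1z, d2z, smul_eq_mul, nsmul_eq_mul, az, map_add, map_mul, map_natCast, map_one,
    Nat.add_sub_cancel]
  push_cast
  ring

/-- `{g(z), x^{i} h}`. -/
theorem br_z (p g h : ℂ[X]) (i : ℕ) :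
    clsL p (pb p (az g) (xP ^ i * az h)) =
      clsL p (xP ^ i * az ((i : ℂ[X]) * derivative g * h)) := by
  apply clsL_congr p _ _ 0
  rcases i with _ | i <;>
  simp only [pb, Derivation.leibniz, Derivation.leibniz_pow, pderiv_az, d0x, d1x, d2x, d0y, d1y,
    d2y, d0z, d1z, d2z, smul_eq_mul, nsmul_eq_mul, az, map_add, map_mul, map_natCast, map_one,
    Nat.add_sub_cancel] <;>
  push_cast <;>
  ring

/-- `{x^N z, x^{i} h}`. -/
theorem br_xx (p h : ℂ[X]) (N i : ℕ) :
    clsL p (pb p (xP ^ (N + 1) * zP) (xP ^ i * az h)) =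
      clsL p (xP ^ (N + 1 + i) * az ((i : ℂ[X]) * h - ((N : ℂ[X]) + 1) * (X * derivative h))) := by
  apply clsL_congr p _ _ 0
  rcases i with _ | i <;>
  simp only [pb, Derivation.leibniz, Derivation.leibniz_pow, pderiv_az, d0x, d1x, d2x, d0y, d1y,
    d2y, d0z, d1z, d2z, smul_eq_mul, nsmul_eq_mul, az, map_add, map_mul, map_natCast, map_one,
    map_sub, Polynomial.aeval_X, Nat.add_sub_cancel] <;>
  push_cast <;>
  ring

/-- `{x^{k+1+m} z, y^{k+1} h}`. -/
theorem br_xy (p h : ℂ[X]) (m k : ℕ) :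
    clsL p (pb p (xP ^ (k + m + 1) * zP) (yP ^ (k + 1) * az h)) =
      clsL p (xP ^ m * az (-((k : ℂ[X]) + 1) * (p ^ (k + 1) * h)
        - ((k : ℂ[X]) + (m : ℂ[X]) + 1) * (X * derivative (p ^ (k + 1) * h)))) := by
  obtain ⟨q, hq⟩ := sub_dvd_pow_sub_pow (xP * yP) (az p) k
  obtain ⟨q', hq'⟩ := sub_dvd_pow_sub_pow (xP * yP) (az p) (k + 1)
  apply clsL_congr p _ _ (xP ^ m *
    (-q * (((k : P3) + (m : P3) + 1) * (k + 1) * zP * az (derivative p) * az h)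
     - q' * (((k : P3) + (m : P3) + 1) * zP * az (derivative h) + (k + 1) * az h)))
  have e : ∀ u v : P3, (xP ^ m * (-q * u - q' * v)) * (xP * yP - az p) =
      xP ^ m * (-((xP * yP - az p) * q) * u - ((xP * yP - az p) * q') * v) := by
    intros; ring
  rw [e, ← hq, ← hq']
  simp only [pb, Derivation.leibniz, Derivation.leibniz_pow, pderiv_az, d0x, d1x, d2x, d0y, d1y,
    d2y, d0z, d1z, d2z, smul_eq_mul, nsmul_eq_mul, az, map_add, map_mul, map_natCast, map_one,
    map_sub, map_neg, map_pow, Polynomial.aeval_X, Nat.add_sub_cancel, Polynomial.derivative_mul,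
    Polynomial.derivative_pow, Polynomial.C_eq_natCast]
  push_cast
  ring

/-- The Euler-type operator is injective. -/
theorem euler_ne (H : ℂ[X]) (hH : H ≠ 0) (α β : ℂ) (h : α + β * H.natDegree ≠ 0) :
    Polynomial.C α * H + Polynomial.C β * (X * derivative H) ≠ 0 := by
  intro h0
  have h1 := congrArg (fun q => q.coeff H.natDegree) h0
  have h2 : (X * derivative H).coeff H.natDegree = H.natDegree * H.leadingCoeff := by
    rcases hn : H.natDegree with _ | n
    · simp
    · rw [Polynomial.coeff_X_mul, Polynomial.coeff_derivative, ← hn, Polynomial.leadingCoeff, hn]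
      push_cast; ring
  simp only [Polynomial.coeff_add, Polynomial.coeff_C_mul, Polynomial.coeff_zero, h2,
    Polynomial.coeff_natDegree] at h1
  have : (α + β * H.natDegree) * H.leadingCoeff = 0 := by rw [← h1]; ring
  rcases mul_eq_zero.1 this with h3 | h3
  · exact h h3
  · exact hH (Polynomial.leadingCoeff_eq_zero.1 h3)

theorem deriv_ne {q : ℂ[X]} (h : 1 ≤ q.natDegree) : derivative q ≠ 0 := by
  intro h0
  have := Polynomial.natDegree_eq_zero_of_derivative_eq_zero h0
  omega

theorem natDegree_deriv (q : ℂ[X]) : (derivative q).natDegree = q.natDegree - 1 := by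
  rcases Nat.eq_zero_or_pos q.natDegree with h | h
  · rw [Polynomial.eq_C_of_natDegree_eq_zero h]; simp
  · exact Polynomial.natDegree_eq_of_degree_eq_some (Polynomial.degree_derivative_eq q h)

theorem top_ne (p h : ℂ[X]) (hp2 : 2 ≤ p.natDegree) (hh : h ≠ 0) (i : ℕ) :
    ((i : ℂ[X]) + 1) * derivative p * h + p * derivative h ≠ 0 := by
  have hp : p ≠ 0 := by rintro rfl; simp at hp2
  intro h0
  have h1 : derivative (p ^ (i + 1) * h) =
      p ^ i * (((i : ℂ[X]) + 1) * derivative p * h + p * derivative h) := by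
    simp only [Polynomial.derivative_mul, Polynomial.derivative_pow, Nat.add_sub_cancel,
      Polynomial.C_eq_natCast]
    push_cast; ring
  rw [h0, mul_zero] at h1
  refine deriv_ne ?_ h1
  rw [Polynomial.natDegree_mul (pow_ne_zero _ hp) hh, Polynomial.natDegree_pow]
  nlinarith

/-- Every element of `V` is the class of a Laurent-type sum. -/
theorem V_repr (p : ℂ[X]) (v : QDan p) (hv : v ∈ Vsub p) :
    ∃ (n : ℕ) (a b : ℕ → ℂ[X]) (h : ℂ[X]), v = clsL p (az h
      + ∑ i ∈ Finset.range n, xP ^ (i + 1) * az (a i)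
      + ∑ i ∈ Finset.range n, yP ^ (i + 1) * az (b i)) := by
  let T : (ℕ →₀ ℂ[X]) × (ℕ →₀ ℂ[X]) × ℂ[X] → P3 := fun t =>
    az t.2.2 + t.1.sum (fun i a => xP ^ (i + 1) * az a)
      + t.2.1.sum (fun i a => yP ^ (i + 1) * az a)
  have key : ∀ w ∈ Submodule.span ℂ (Sgen p), ∃ t, w = Ideal.Quotient.mk (relIdeal p) (T t) := by
    intro w hw
    induction hw using Submodule.span_induction with
    | mem w hw =>
      rcases hw with ⟨i, j, hi, rfl⟩ | ⟨i, j, hi, rfl⟩ | ⟨r, rfl⟩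
      · refine ⟨(Finsupp.single (i - 1) (X ^ j), 0, 0), ?_⟩
        simp [T, az, Finsupp.sum_single_index, Nat.sub_add_cancel hi]
      · refine ⟨(0, Finsupp.single (i - 1) (X ^ j), 0), ?_⟩
        simp [T, az, Finsupp.sum_single_index, Nat.sub_add_cancel hi]
      · refine ⟨(0, 0, derivative (p * r)), ?_⟩
        simp [T, az]
    | zero => exact ⟨0, by simp [T, az]⟩
    | add u w _ _ hu hw =>
      obtain ⟨s, rfl⟩ := hu
      obtain ⟨t, rfl⟩ := hw
      refine ⟨s + t, ?_⟩
      rw [← map_add]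
      congr 1
      simp only [T, Prod.fst_add, Prod.snd_add]
      rw [Finsupp.sum_add_index' (by simp [az]) (by intros; simp [az, mul_add]),
        Finsupp.sum_add_index' (by simp [az]) (by intros; simp [az, mul_add])]
      simp only [az, map_add]
      ring
    | smul c w _ hw =>
      obtain ⟨t, rfl⟩ := hw
      refine ⟨c • t, ?_⟩
      have : c • (Ideal.Quotient.mk (relIdeal p) (T t)) =
        Ideal.Quotient.mk (relIdeal p) (c • T t) := rfl
      rw [this]
      congr 1
      simp only [T, Prod.smul_fst, Prod.smul_snd]
      rw [Finsupp.sum_smul_index' (by simp [az]), Finsupp.sum_smul_index' (by simp [az])]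
      simp only [az, map_smul, smul_add, Finsupp.smul_sum, mul_smul_comm]
  obtain ⟨w, hw, rfl⟩ := hv
  obtain ⟨⟨a, b, h⟩, rfl⟩ := key w hw
  obtain ⟨n, hn⟩ := (a.support ∪ b.support).exists_nat_subset_range
  refine ⟨n, a, b, h, ?_⟩
  change clsL p (T (a, b, h)) = _
  congr 1
  simp only [T]
  rw [Finsupp.sum_of_support_subset a (Finset.subset_union_left.trans hn) _ (by simp [az]),
    Finsupp.sum_of_support_subset b (Finset.subset_union_right.trans hn) _ (by simp [az])]

section
variable (p : ℂ[X])

theorem mem_x (i j : ℕ) (hi : 1 ≤ i) : clsL p (xP ^ i * zP ^ j) ∈ Vsub p :=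
  ⟨_, Submodule.subset_span (Or.inl ⟨i, j, hi, rfl⟩), rfl⟩

theorem mem_y (i j : ℕ) (hi : 1 ≤ i) : clsL p (yP ^ i * zP ^ j) ∈ Vsub p :=
  ⟨_, Submodule.subset_span (Or.inr (Or.inl ⟨i, j, hi, rfl⟩)), rfl⟩

theorem mem_z : clsL p (az (derivative p)) ∈ Vsub p :=
  ⟨_, Submodule.subset_span (Or.inr (Or.inr ⟨1, rfl⟩)), by rw [mul_one]; rfl⟩

end

/-- Descent on the `x`-degree. -/
theorem descent (p : ℂ[X]) (hp2 : 2 ≤ p.natDegree)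
    (B : QDan p →ₗ[ℂ] QDan p →ₗ[ℂ] QDan p)
    (hB : ∀ f g : P3, B (clsL p f) (clsL p g) = clsL p (pb p f g))
    (I : Submodule ℂ (QDan p))
    (hIdeal : ∀ g ∈ Vsub p, ∀ f ∈ I, B g f ∈ I) (n : ℕ) :
    ∀ a : ℕ → ℂ[X], (∃ i < n, a i ≠ 0) →
      clsL p (∑ i ∈ Finset.range n, xP ^ (i + 1) * az (a i)) ∈ I →
      ∃ h : ℂ[X], 1 ≤ h.natDegree ∧ clsL p (az h) ∈ I := by
  have hp : p ≠ 0 := by rintro rfl; simp at hp2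
  induction n with
  | zero => rintro a ⟨i, hi, _⟩; omega
  | succ n ih =>
    intro a hne ha
    by_cases htop : a n = 0
    · refine ih a ?_ ?_
      · obtain ⟨i, hi, hi0⟩ := hne
        refine ⟨i, ?_, hi0⟩
        rcases Nat.lt_succ_iff_lt_or_eq.1 hi with h | rfl
        · exact h
        · exact absurd htop hi0
      · rw [Finset.sum_range_succ, htop] at ha
        simpa [az] using ha
    · have hy : clsL p yP ∈ Vsub p := by simpa using mem_y p 1 0 le_rfl
      have h1 := hIdeal _ hy _ ha
      rw [map_sum, map_sum] at h1
      simp only [hB, br_y] at h1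
      rcases n with _ | n
      · refine ⟨derivative (p * a 0), ?_, ?_⟩
        · rw [natDegree_deriv, Polynomial.natDegree_mul hp htop]; omega
        · convert h1 using 1
          simp [Polynomial.derivative_mul]
      · have h2 := hIdeal _ (mem_z p) _ h1
        rw [map_sum] at h2
        simp only [hB, br_z] at h2
        rw [Finset.sum_range_succ'] at h2
        refine ih (fun i => ((i + 1 : ℕ) : ℂ[X]) * derivative (derivative p) *
          ((((i + 1 : ℕ) : ℂ[X]) + 1) * derivative p * a (i + 1) + p * derivative (a (i + 1))))
          ⟨n, by omega, ?_⟩ ?_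
        · refine mul_ne_zero (mul_ne_zero ?_ ?_) (top_ne p _ hp2 htop _)
          · exact Nat.cast_ne_zero.2 (by omega)
          · apply deriv_ne
            rw [natDegree_deriv]; omega
        · rw [map_sum]
          convert h2 using 1
          simp [az]

/-- Let `p` be squarefree of degree at least `2`, and let `{·,·}` denote the induced
bracket on `O(D_p)/ℂ·1`.  If `Ĩ ⊆ V` is a nonzero `ℂ`-subspace with `{g,f} ∈ Ĩ` for all
`g ∈ V`, `f ∈ Ĩ`, then `Ĩ` contains the class of a nonconstant polynomial `h(z)`. -/
theorem ideal_contains_poly_in_z (p : ℂ[X])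
    (hsp : Squarefree p) (hp2 : 2 ≤ p.natDegree)
    (B : QDan p →ₗ[ℂ] QDan p →ₗ[ℂ] QDan p)
    (hB : ∀ f g : P3, B (cls p f) (cls p g) = cls p (pb p f g))
    (I : Submodule ℂ (QDan p)) (hIV : I ≤ Vsub p) (hI0 : I ≠ ⊥)
    (hIdeal : ∀ g ∈ Vsub p, ∀ f ∈ I, B g f ∈ I) :
    ∃ h : ℂ[X], 1 ≤ h.natDegree ∧ cls p (Polynomial.aeval zP h) ∈ I := by
  have hB' : ∀ f g : P3, B (clsL p f) (clsL p g) = clsL p (pb p f g) := hB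
  change ∃ h : ℂ[X], 1 ≤ h.natDegree ∧ clsL p (az h) ∈ I
  have hp : p ≠ 0 := by rintro rfl; simp at hp2
  obtain ⟨v, hvI, hv0⟩ := Submodule.exists_mem_ne_zero_of_ne_bot hI0
  obtain ⟨n, a, b, h, rfl⟩ := V_repr p v (hIV hvI)
  have hx : clsL p (xP ^ (n + 1) * zP) ∈ Vsub p := by
    simpa using mem_x p (n + 1) 1 (by omega)
  have h1 := hIdeal _ hx _ hvI
  let A : ℕ → ℂ[X] := fun i =>
    ((i + 1 : ℕ) : ℂ[X]) * a i - ((n : ℂ[X]) + 1) * (X * derivative (a i))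
  let H : ℂ[X] := ((0 : ℕ) : ℂ[X]) * h - ((n : ℂ[X]) + 1) * (X * derivative h)
  let D : ℕ → ℂ[X] := fun i => -((i : ℂ[X]) + 1) * (p ^ (i + 1) * b i)
        - ((n : ℂ[X]) + 1) * (X * derivative (p ^ (i + 1) * b i))
  have eA : ∀ i, B (clsL p (xP ^ (n + 1) * zP)) (clsL p (xP ^ (i + 1) * az (a i))) =
      clsL p (xP ^ (n + 1 + i + 1) * az (A i)) := by
    intro i
    rw [hB', br_xx]; first | done | rfl
  have eH : B (clsL p (xP ^ (n + 1) * zP)) (clsL p (az h)) =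
      clsL p (xP ^ (n + 1) * az H) := by
    have := br_xx p h n 0
    rw [pow_zero, one_mul] at this
    rw [hB', this]
  have eD : ∀ i ∈ Finset.range n,
      B (clsL p (xP ^ (n + 1) * zP)) (clsL p (yP ^ (i + 1) * az (b i))) =
      clsL p (xP ^ (n - 1 - i + 1) * az (D i)) := by
    intro i hi
    have hi := Finset.mem_range.1 hi
    obtain ⟨m, rfl⟩ := Nat.exists_eq_add_of_lt hi
    have := br_xy p (b i) (m + 1) i
    rw [show i + (m + 1) + 1 = i + m + 1 + 1 by ring] at this
    rw [hB', this, show i + m + 1 - 1 - i + 1 = m + 1 by omega]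
    simp only [D]
    push_cast
    simp only [add_assoc]
  let c : ℕ → ℂ[X] := fun k =>
    if k < n then D (n - 1 - k) else if k = n then H else A (k - (n + 1))
  have hc : clsL p (∑ k ∈ Finset.range (n + 1 + n), xP ^ (k + 1) * az (c k)) ∈ I := by
    convert h1 using 1
    simp only [map_add, map_sum, eA, eH]
    rw [Finset.sum_congr rfl eD, Finset.sum_range_add, Finset.sum_range_succ,
      ← Finset.sum_range_reflect (fun i => clsL p (xP ^ (n - 1 - i + 1) * az (D i))) n]
    have s1 : ∀ k ∈ Finset.range n, clsL p (xP ^ (k + 1) * az (c k)) =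
        clsL p (xP ^ (n - 1 - (n - 1 - k) + 1) * az (D (n - 1 - k))) := by
      intro k hk
      have hk := Finset.mem_range.1 hk
      rw [show n - 1 - (n - 1 - k) = k by omega]
      simp only [c, if_pos hk]
    have s2 : c n = H := by simp [c]
    have s3 : ∀ i, c (n + 1 + i) = A i := by
      intro i
      simp only [c]
      rw [if_neg (by omega), if_neg (by omega)]
      congr 1; omega
    rw [Finset.sum_congr rfl s1, s2]
    simp only [s3]
    abel
  refine descent p hp2 B hB' I hIdeal _ c ?_ hc
  by_contra! hall
  have ha : ∀ i < n, a i = 0 := by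
    intro i hi
    by_contra hai
    have h0 := hall (n + 1 + i) (by omega)
    simp only [c] at h0
    rw [if_neg (by omega), if_neg (by omega), show n + 1 + i - (n + 1) = i by omega] at h0
    refine euler_ne (a i) hai ((i + 1 : ℕ) : ℂ) (-((n + 1 : ℕ) : ℂ)) ?_ ?_
    · intro h2
      have h3 : ((i + 1 : ℕ) : ℂ) = ((n + 1) * (a i).natDegree : ℕ) := by
        push_cast at h2 ⊢; linear_combination h2
      have h4 : i + 1 = (n + 1) * (a i).natDegree := by exact_mod_cast h3
      rcases Nat.eq_zero_or_pos (a i).natDegree with h5 | h5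
      · rw [h5] at h4; omega
      · nlinarith
    · rw [← h0]
      simp only [A, map_neg, map_natCast]
      push_cast; ring
  have hb : ∀ i < n, b i = 0 := by
    intro i hi
    by_contra hbi
    have h0 := hall (n - 1 - i) (by omega)
    simp only [c] at h0
    rw [if_pos (by omega), show n - 1 - (n - 1 - i) = i by omega] at h0
    refine euler_ne (p ^ (i + 1) * b i) (mul_ne_zero (pow_ne_zero _ hp) hbi)
      (-((i + 1 : ℕ) : ℂ)) (-((n + 1 : ℕ) : ℂ)) ?_ ?_
    · intro h2
      have h3 : (((i + 1) + (n + 1) * (p ^ (i + 1) * b i).natDegree : ℕ) : ℂ) = 0 := by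
        push_cast at h2 ⊢; linear_combination -h2
      have h4 := Nat.cast_eq_zero.1 h3
      omega
    · rw [← h0]
      simp only [D, map_neg, map_natCast]
      push_cast; ring
  have hh : derivative h = 0 := by
    have h0 := hall n (by omega)
    simp only [c, H, lt_irrefl, if_false, if_true, Nat.cast_zero, zero_mul, zero_sub,
      neg_eq_zero] at h0
    have h5 : ((n : ℂ[X]) + 1) ≠ 0 := by exact_mod_cast Nat.succ_ne_zero n
    rcases mul_eq_zero.1 h0 with h6 | h6
    · exact absurd h6 h5
    · exact (mul_eq_zero.1 h6).resolve_left Polynomial.X_ne_zero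
  apply hv0
  rw [Finset.sum_eq_zero (fun i hi => by rw [ha i (Finset.mem_range.1 hi)]; simp [az]),
    Finset.sum_eq_zero (fun i hi => by rw [hb i (Finset.mem_range.1 hi)]; simp [az]),
    Polynomial.eq_C_of_natDegree_eq_zero (Polynomial.natDegree_eq_zero_of_derivative_eq_zero hh),
    add_zero, add_zero, clsL_C]

end
end
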